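/- Let ρ > 0, let a ∈ ℝ^m, z, b ∈ ℝ^n, let W⁰ be a real n×m matrix, and let θ be an n×m matrix with strictly positive entries. Define φ(W) = (ρ/2)‖z − W a − b‖₂² for n×m matrices W, whose gradient is ∇φ(W) = ρ(W a + b − z) aᵀ, and define P(W) = φ(W⁰) + ⟨∇φ(W⁰), W − W⁰⟩_F + (1/2)∑_{i,j} θ_{ij}(W_{ij} − W⁰_{ij})². Let Ω be a convex function on n×m matrices. Suppose W' minimizes P + Ω over all n×m matrices and satisfies the backtracking condition φ(W') ≤ P(W'). Then (φ(W⁰) + Ω(W⁰)) − (φ(W') + Ω(W')) ≥ (1/2)∑_{i,j} θ_{ij}(W'_{ij} − W⁰_{ij})². -/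

import Mathlib

/-- A real number bounded by `t * q` for every `t ∈ (0, 1]` is nonpositive. -/
theorem nonpos_of_forall_le_mul {c q : ℝ} (hq : 0 ≤ q)
    (h : ∀ t : ℝ, 0 < t → t ≤ 1 → c ≤ t * q) : c ≤ 0 := by
  by_contra! hc
  have hs : 0 < c + q := by linarith
  have hle := h (c / (c + q)) (div_pos hc hs) ((div_le_one hs).2 (by linarith))
  rw [div_mul_eq_mul_div, le_div_iff₀ hs] at hle
  nlinarith [mul_pos hc hc]

/-- At a minimizer `x'` of `P + Ω`, with `Ω` convex and `P` equal to `p + (1 - t) * l + (1 - t) ^ 2 * q`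
along the segment from `x'` to `x₀`, the quadratic term enters the optimality condition twice. -/
theorem ConvexOn.add_two_mul_le_of_forall_le {E : Type*} [AddCommGroup E] [Module ℝ E]
    {P Ω : E → ℝ} (hΩ : ConvexOn ℝ Set.univ Ω) {x₀ x' : E} {p l q : ℝ} (hq : 0 ≤ q)
    (hP : ∀ t : ℝ, P ((1 - t) • x' + t • x₀) = p + (1 - t) * l + (1 - t) ^ 2 * q)
    (hmin : ∀ x, P x' + Ω x' ≤ P x + Ω x) :
    l + 2 * q + Ω x' ≤ Ω x₀ := by
  have hP' : P x' = p + l + q := by simpa using hP 0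
  suffices l + 2 * q + Ω x' - Ω x₀ ≤ 0 by linarith
  refine nonpos_of_forall_le_mul hq fun t ht ht1 => ?_
  have hconv := hΩ.2 (Set.mem_univ x') (Set.mem_univ x₀) (sub_nonneg.2 ht1) ht.le
    (sub_add_cancel 1 t)
  have hle := hmin ((1 - t) • x' + t • x₀)
  rw [hP, hP'] at hle
  simp only [smul_eq_mul] at hconv
  refine le_of_mul_le_mul_left ?_ ht
  linarith

open Finset in
/-- Equation (9) in Lemma 3 (sufficient descent for the W-update): with
`φ(W) = (ρ/2)‖z - W a - b‖₂²`, `∇φ(W⁰) = ρ(W⁰ a + b - z) aᵀ`,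
`P(W) = φ(W⁰) + ⟨∇φ(W⁰), W - W⁰⟩_F + (1/2)∑ᵢⱼ θᵢⱼ(Wᵢⱼ - W⁰ᵢⱼ)²`, a convex
regularizer `Ω`, a minimizer `W'` of `P + Ω` satisfying the backtracking
condition `φ(W') ≤ P(W')`, one has
`(φ(W⁰) + Ω(W⁰)) - (φ(W') + Ω(W')) ≥ (1/2)∑ᵢⱼ θᵢⱼ(W'ᵢⱼ - W⁰ᵢⱼ)²`. -/
theorem W_update_sufficient_descent
    (n m : ℕ) (ρ : ℝ) (hρ : 0 < ρ)
    (a : Fin m → ℝ) (z b : Fin n → ℝ)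
    (W0 : Matrix (Fin n) (Fin m) ℝ)
    (θ : Matrix (Fin n) (Fin m) ℝ) (hθ : ∀ i j, 0 < θ i j)
    (φ : Matrix (Fin n) (Fin m) ℝ → ℝ)
    (hφ : ∀ W, φ W = (ρ / 2) * ∑ i, (z i - W.mulVec a i - b i) ^ 2)
    (P : Matrix (Fin n) (Fin m) ℝ → ℝ)
    (hP : ∀ W, P W = φ W0 +
      (∑ i, ∑ j, (ρ * (W0.mulVec a i + b i - z i) * a j) * (W i j - W0 i j)) +
      (1 / 2) * ∑ i, ∑ j, θ i j * (W i j - W0 i j) ^ 2)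
    (Ω : Matrix (Fin n) (Fin m) ℝ → ℝ) (hΩ : ConvexOn ℝ Set.univ Ω)
    (W' : Matrix (Fin n) (Fin m) ℝ)
    (hmin : ∀ W, P W' + Ω W' ≤ P W + Ω W)
    (hback : φ W' ≤ P W') :
    (φ W0 + Ω W0) - (φ W' + Ω W') ≥
      (1 / 2) * ∑ i, ∑ j, θ i j * (W' i j - W0 i j) ^ 2 := by
  have hq : 0 ≤ (1 / 2) * ∑ i, ∑ j, θ i j * (W' i j - W0 i j) ^ 2 :=
    mul_nonneg (by norm_num) <| sum_nonneg fun i _ => sum_nonneg fun j _ =>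
      mul_nonneg (hθ i j).le (sq_nonneg _)
  have hseg (t : ℝ) : P ((1 - t) • W' + t • W0) = φ W0 +
      (1 - t) * (∑ i, ∑ j, (ρ * (W0.mulVec a i + b i - z i) * a j) * (W' i j - W0 i j)) +
      (1 - t) ^ 2 * ((1 / 2) * ∑ i, ∑ j, θ i j * (W' i j - W0 i j) ^ 2) := by
    have hentry (i : Fin n) (j : Fin m) :
        ((1 - t) • W' + t • W0) i j - W0 i j = (1 - t) * (W' i j - W0 i j) := by
      simp only [Matrix.add_apply, Matrix.smul_apply, smul_eq_mul]
      ring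
    simp only [hP, hentry, mul_pow, mul_left_comm _ (1 - t), mul_left_comm _ ((1 - t) ^ 2),
      ← mul_sum]
  have hopt := hΩ.add_two_mul_le_of_forall_le hq hseg hmin
  have hPW' := hP W'
  linarith
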